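/- Let V : H → H be the (unweighted) unilateral shift, V e_n = e_{n+1}. Then U − V is a compact operator, and the closed star-subalgebra of bounded operators on H generated by U coincides with the closed star-subalgebra generated by V; in particular the C*-algebra C(D_q) := C*(U) is isomorphic to the Toeplitz algebra. -/

import Mathlib

open MeasureTheory InnerProductSpace

noncomputable section

/-- `H = ℓ²(ℕ, ℂ)`. -/
abbrev H : Type := lp (fun _ : ℕ => ℂ) 2

/-- The standard orthonormal basis `e n` of `ℓ²(ℕ, ℂ)`. -/
noncomputable def e (n : ℕ) : H := lp.single 2 n 1

lemma e_apply (n m : ℕ) : (e n : ℕ → ℂ) m = if m = n then 1 else 0 := by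
  simp [e, lp.single_apply, Pi.single_apply]

lemma inner_e_left (n : ℕ) (x : H) : inner ℂ (e n) x = x n := by
  simp [e, lp.inner_single_left]

lemma hasSum_smul_e (x : H) : HasSum (fun n => x n • e n) x := by
  have h := lp.hasSum_single (p := 2) (by simp) x
  convert h using 2 with n
  rw [e, ← lp.single_smul, smul_eq_mul, mul_one]

lemma hasSum_norm_sq (x : H) : HasSum (fun n => ‖x n‖ ^ 2) (‖x‖ ^ 2) := by
  simpa using lp.hasSum_norm (p := 2) (by simp) x

/-- `T` is the weighted shift with weights `w`. -/
def IsWeightedShift (w : ℕ → ℝ) (T : H →L[ℂ] H) : Prop :=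
  ∀ n, T (e n) = (w n : ℂ) • e (n + 1)

namespace IsWeightedShift

variable {w : ℕ → ℝ} {T : H →L[ℂ] H}

lemma hasSum_apply (h : IsWeightedShift w T) (x : H) (m : ℕ) :
    HasSum (fun n => x n * (w n * if m = n + 1 then 1 else 0)) (T x m) := by
  have h1 := ((hasSum_smul_e x).mapL T).mapL (lp.evalCLM ℂ (fun _ : ℕ => ℂ) 2 m)
  refine HasSum.congr_fun h1 fun n => ?_
  symm
  rw [map_smul, h n]
  change x n • ((w n : ℂ) • (e (n + 1) : ℕ → ℂ) m) = _
  rw [e_apply, smul_eq_mul, smul_eq_mul]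

lemma apply_zero (h : IsWeightedShift w T) (x : H) : T x 0 = 0 := by
  simpa using (h.hasSum_apply x 0).tsum_eq.symm

lemma apply_succ (h : IsWeightedShift w T) (x : H) (m : ℕ) : T x (m + 1) = w m * x m := by
  rw [← (h.hasSum_apply x (m + 1)).tsum_eq, tsum_eq_single m]
  · simp [mul_comm]
  · intro n hn
    simp [hn.symm]

lemma norm_le (h : IsWeightedShift w T) {C : ℝ} (hC : ∀ n, |w n| ≤ C) : ‖T‖ ≤ C := by
  have hC0 : 0 ≤ C := (abs_nonneg _).trans (hC 0)
  refine T.opNorm_le_bound hC0 fun x => ?_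
  have h1 := (hasSum_nat_add_iff' 1).2 (hasSum_norm_sq (T x))
  simp only [Finset.sum_range_one, h.apply_zero, h.apply_succ, norm_zero] at h1
  have h2 := (hasSum_norm_sq x).mul_left (C ^ 2)
  have h3 : ‖T x‖ ^ 2 ≤ C ^ 2 * ‖x‖ ^ 2 := by
    refine le_trans (by simp) (hasSum_le (fun n => ?_) h1 h2)
    rw [norm_mul, mul_pow, Complex.norm_real, Real.norm_eq_abs]
    have := hC n
    gcongr
  rw [← mul_pow] at h3
  exact (sq_le_sq₀ (norm_nonneg _) (by positivity)).1 h3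

lemma star_apply_zero (h : IsWeightedShift w T) : star T (e 0) = 0 := by
  ext m
  rw [← inner_e_left, ContinuousLinearMap.star_eq_adjoint,
    ContinuousLinearMap.adjoint_inner_right, h m, inner_smul_left, inner_e_left, e_apply]
  simp

lemma star_apply_succ (h : IsWeightedShift w T) (n : ℕ) :
    star T (e (n + 1)) = (w n : ℂ) • e n := by
  ext m
  rw [← inner_e_left, ContinuousLinearMap.star_eq_adjoint,
    ContinuousLinearMap.adjoint_inner_right, h m, inner_smul_left, inner_e_left, e_apply,
    lp.coeFn_smul, Pi.smul_apply, e_apply]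
  by_cases hm : m = n <;> simp [hm]

lemma sub {w' : ℕ → ℝ} {T' : H →L[ℂ] H} (h : IsWeightedShift w T) (h' : IsWeightedShift w' T') :
    IsWeightedShift (fun n => w n - w' n) (T - T') := fun n => by
  simp [h n, h' n, sub_smul]

open Filter in
/-- A weighted shift whose weights tend to zero is the limit of its truncations. -/
lemma tendsto_sum (h : IsWeightedShift w T) (hw : Tendsto w atTop (nhds 0))
    {S : ℕ → H →L[ℂ] H} (hS : ∀ n m, S n (e m) = if m = n then e (n + 1) else 0) :
    Tendsto (fun N => ∑ n ∈ Finset.range N, (w n : ℂ) • S n) atTop (nhds T) := by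
  rw [Metric.tendsto_atTop]
  intro ε hε
  obtain ⟨N, hN⟩ := Metric.tendsto_atTop.1 hw (ε / 2) (by positivity)
  refine ⟨N, fun M hM => ?_⟩
  have hT : IsWeightedShift (fun n => w n - if n < M then w n else 0)
      (T - ∑ n ∈ Finset.range M, (w n : ℂ) • S n) := by
    refine h.sub fun m => ?_
    simp only [_root_.sum_apply, _root_.smul_apply, hS, smul_ite, smul_zero]
    simp only [Finset.sum_ite_eq, Finset.mem_range]
    split_ifs <;> simp
  rw [dist_comm, dist_eq_norm]
  refine (hT.norm_le (C := ε / 2) fun n => ?_).trans_lt (by linarith)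
  split_ifs with hn
  · simp; positivity
  · simpa using (hN n (by lia)).le

lemma isCompactOperator (h : IsWeightedShift w T) (hw : Filter.Tendsto w Filter.atTop (nhds 0)) :
    IsCompactOperator T := by
  have hT := h.tendsto_sum hw
    (S := fun n => (lp.evalCLM ℂ (fun _ : ℕ => ℂ) 2 n).smulRight (e (n + 1))) fun n m => by
      change (e m : ℕ → ℂ) n • e (n + 1) = _
      rw [e_apply]
      by_cases hm : m = n
      · simp [hm]
      · simp [hm, Ne.symm hm]
  refine isCompactOperator_of_tendsto hT (.of_forall fun N => ?_)
  refine (compactOperator (RingHom.id ℂ) H H).sum_mem fun n _ =>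
    (compactOperator (RingHom.id ℂ) H H).smul_mem _ ?_
  exact (isCompactOperator_of_locallyCompactSpace_rng
    (ContinuousLinearMap.toSpanSingleton ℂ (e (n + 1)))).comp_clm
      (lp.evalCLM ℂ (fun _ : ℕ => ℂ) 2 n)

/-- A perturbation of the unilateral shift by a weighted shift with weights tending to zero lies in
the Toeplitz algebra. -/
lemma mem_closure_adjoin_shift {V : H →L[ℂ] H} (hV : IsWeightedShift 1 V)
    (h : IsWeightedShift w T) (hw : Filter.Tendsto w Filter.atTop (nhds 0)) :
    T ∈ (StarAlgebra.adjoin ℂ {V}).topologicalClosure := by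
  have hVmem := StarAlgebra.self_mem_adjoin_singleton ℂ V
  let P : ℕ → H →L[ℂ] H := fun n => Nat.rec (1 - V * star V) (fun _ Q => V * Q * star V) n
  have hP0 : P 0 = 1 - V * star V := rfl
  have hPs (n : ℕ) : P (n + 1) = V * P n * star V := rfl
  have hV' (n : ℕ) : V (e n) = e (n + 1) := by simpa using hV n
  have hVs (n : ℕ) : star V (e (n + 1)) = e n := by simpa using hV.star_apply_succ n
  have hP (n m : ℕ) : P n (e m) = if m = n then e n else 0 := by
    induction n generalizing m with
    | zero => cases m <;> simp [hP0, hV.star_apply_zero, hVs, hV']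
    | succ n ih =>
      cases m with
      | zero => simp [hPs, hV.star_apply_zero]
      | succ m =>
        simp only [hPs, mul_apply_eq_comp, hVs, ih, apply_ite V, hV', map_zero,
          Nat.succ_inj]
  have hPmem (n : ℕ) : P n ∈ StarAlgebra.adjoin ℂ {V} := by
    induction n with
    | zero => exact sub_mem (one_mem _) (mul_mem hVmem (star_mem hVmem))
    | succ n ih => exact mul_mem (mul_mem hVmem ih) (star_mem hVmem)
  have hT := h.tendsto_sum hw (S := fun n => V * P n) fun n m => by
    simp only [mul_apply_eq_comp, hP, apply_ite V, hV', map_zero]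
  rw [← SetLike.mem_coe, StarSubalgebra.topologicalClosure_coe]
  exact mem_closure_of_tendsto hT <| .of_forall fun N =>
    sum_mem fun n _ => SMulMemClass.smul_mem _ (mul_mem hVmem (hPmem n))

/-- The unilateral shift lies in the C⋆-algebra generated by a weighted shift whose weights are
bounded and bounded away from zero. -/
lemma shift_mem_closure_adjoin {V : H →L[ℂ] H} (hV : IsWeightedShift 1 V)
    (h : IsWeightedShift w T) {a : ℝ} (ha : 0 < a) (hw : ∀ n, w n ∈ Set.Icc a 1) :
    V ∈ (StarAlgebra.adjoin ℂ {T}).topologicalClosure := by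
  have hTmem := StarAlgebra.self_mem_adjoin_singleton ℂ T
  rw [← SetLike.mem_coe, StarSubalgebra.topologicalClosure_coe, Metric.mem_closure_iff]
  intro ε hε
  have hcont : ContinuousOn (fun x : ℝ => (√x)⁻¹) (Set.Icc (a ^ 2) 1) :=
    Real.continuous_sqrt.continuousOn.inv₀ fun x hx =>
      (Real.sqrt_pos.2 ((by positivity : 0 < a ^ 2).trans_le hx.1)).ne'
  obtain ⟨p, hp⟩ := exists_polynomial_near_of_continuousOn _ _ _ hcont (ε / 2) (by positivity)
  let B : H →L[ℂ] H :=
    ∑ i ∈ Finset.range (p.natDegree + 1), (p.coeff i : ℂ) • (star T * T) ^ i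
  have hB (n : ℕ) : B (e n) = ((p.eval (w n ^ 2) : ℝ) : ℂ) • e n := by
    have hpow (i : ℕ) : ((star T * T) ^ i) (e n) = ((w n ^ 2) ^ i : ℂ) • e n := by
      induction i with
      | zero => simp
      | succ i ih =>
        rw [pow_succ', mul_apply_eq_comp, ih, map_smul, mul_apply_eq_comp,
          h n, map_smul, h.star_apply_succ, smul_smul, smul_smul]
        congr 1
        ring
    simp only [B, _root_.sum_apply, _root_.smul_apply, hpow, smul_smul,
      ← Finset.sum_smul, Polynomial.eval_eq_sum_range]
    push_cast
    rfl
  have hBmem : B ∈ StarAlgebra.adjoin ℂ {T} :=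
    sum_mem fun i _ => SMulMemClass.smul_mem _ (pow_mem (mul_mem (star_mem hTmem) hTmem) i)
  refine ⟨T * B, mul_mem hTmem hBmem, ?_⟩
  have hTB : IsWeightedShift (fun n => p.eval (w n ^ 2) * w n) (T * B) := fun n => by
    rw [mul_apply_eq_comp, hB, map_smul, h n, smul_smul, Complex.ofReal_mul]
  rw [dist_comm, dist_eq_norm]
  refine ((hTB.sub hV).norm_le (C := ε / 2) fun n => ?_).trans_lt (by linarith)
  obtain ⟨h1, h2⟩ := hw n
  have h0 : 0 < w n := ha.trans_le h1
  have h3 := hp (w n ^ 2) ⟨by gcongr, pow_le_one₀ h0.le h2⟩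
  rw [Real.sqrt_sq h0.le] at h3
  calc |p.eval (w n ^ 2) * w n - 1| = |p.eval (w n ^ 2) - (w n)⁻¹| * w n := by
        rw [← abs_of_pos h0, ← abs_mul, abs_of_pos h0, sub_mul, inv_mul_cancel₀ h0.ne']
    _ ≤ ε / 2 * 1 := by gcongr
    _ = ε / 2 := mul_one _

end IsWeightedShift

/-- `U − V` is compact, where `V` is the unweighted unilateral shift, and the closed
star-subalgebras generated by `U` and by `V` coincide; in particular
`C(D_q) = C*(U)` is isomorphic to the Toeplitz algebra `C*(V)`. -/
theorem stmt1 (q : ℝ) (hq0 : 0 < q) (hq1 : q < 1) (U V : H →L[ℂ] H)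
    (hU : ∀ n : ℕ, U (e n) = (Real.sqrt (1 - q ^ (n + 1)) : ℂ) • e (n + 1))
    (hV : ∀ n : ℕ, V (e n) = e (n + 1)) :
    IsCompactOperator ⇑(U - V) ∧
    (StarAlgebra.adjoin ℂ {U}).topologicalClosure
      = (StarAlgebra.adjoin ℂ {V}).topologicalClosure := by
  have hU' : IsWeightedShift (fun n => √(1 - q ^ (n + 1))) U := hU
  have hV' : IsWeightedShift 1 V := fun n => by simp [hV n]
  have hlim : Filter.Tendsto (fun n : ℕ => √(1 - q ^ (n + 1)) - 1) Filter.atTop (nhds 0) := by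
    have h1 := (Filter.tendsto_add_atTop_iff_nat 1).2
      (tendsto_pow_atTop_nhds_zero_of_lt_one hq0.le hq1)
    simpa using ((h1.const_sub 1).sqrt).sub_const 1
  have hUV := hU'.sub hV'
  refine ⟨hUV.isCompactOperator hlim, le_antisymm ?_ ?_⟩ <;>
    refine StarSubalgebra.topologicalClosure_minimal
      (StarAlgebra.adjoin_le_iff.2 (Set.singleton_subset_iff.2 ?_))
      (StarSubalgebra.isClosed_topologicalClosure _)
  · have h := add_mem (hV'.mem_closure_adjoin_shift hUV hlim)
      (StarSubalgebra.le_topologicalClosure _ (StarAlgebra.self_mem_adjoin_singleton ℂ V))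
    rwa [sub_add_cancel] at h
  · refine hV'.shift_mem_closure_adjoin hU' (Real.sqrt_pos.2 (sub_pos.2 hq1)) fun n => ⟨?_, ?_⟩
    · exact Real.sqrt_le_sqrt (sub_le_sub_left (pow_le_of_le_one hq0.le hq1.le n.succ_ne_zero) 1)
    · exact Real.sqrt_le_one.2 (sub_le_self 1 (by positivity))

end
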